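/- Let {D_j} be a finite collection of 100-separated closed unit disks in the plane with 0 ∉ ∪_j 3D_j, let R ≥ 2^{10}, and let h be a real-valued harmonic function in B(0,R) ∖ ∪_j D_j that does not change sign in (5D_j ∖ D_j) ∩ B(0,R) for each j. Let C_H ≥ 10 be a constant for which the conclusions of Lemma 2.1 hold for h, namely max_{∂(3D_j)} |h| ≤ C_H min_{∂(3D_j)} |h| and max_{∂(3D_j)} |∇h| ≤ C_H min_{∂(3D_j)} |h| for every j whose tripled disk lies in B(0,R). Let r ∈ (0, R/2^{10}) and let k ≥ 2 C_H R. Define Ω = {z : r/2 < |z| < R − 1} ∖ ∪_j 3D_j, and let W₁ be the connected component of ∂Ω that intersects the circle {|z| = r/2}. If sup_{z ∈ B(0,r) ∖ ∪ 3D_j} |h(z)| ≤ (16r/R)^{3k}, then sup_{W₁} |h| ≤ (16r/R)^{2k} and sup_{W₁} |∇h| ≤ (16r/R)^{2k}. -/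

import Mathlib

/-- The Laplacian of a function `u : ℂ → ℝ`, viewing `ℂ` as `ℝ²`:
`Δu = ∂²u/∂x² + ∂²u/∂y²`. -/
noncomputable def planeLaplacian (u : ℂ → ℝ) (z : ℂ) : ℝ :=
  fderiv ℝ (fun w => fderiv ℝ u w 1) z 1
    + fderiv ℝ (fun w => fderiv ℝ u w Complex.I) z Complex.I

/-- The Euclidean norm of the gradient of `u : ℂ → ℝ`:
`|∇u| = √((∂_x u)² + (∂_y u)²)`. -/
noncomputable def gradNorm (u : ℂ → ℝ) (z : ℂ) : ℝ :=
  Real.sqrt ((fderiv ℝ u z 1) ^ 2 + (fderiv ℝ u z Complex.I) ^ 2)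

open Metric Set

namespace W1Bound

/-- The Laplacian `planeLaplacian` agrees with Mathlib's Laplacian at points of `C²` regularity. -/
lemma laplacian_eq_planeLaplacian {u : ℂ → ℝ} {z : ℂ} (hu : ContDiffAt ℝ 2 u z) :
    Laplacian.laplacian u z = planeLaplacian u z := by
  have hd : DifferentiableAt ℝ (fderiv ℝ u) z :=
    (hu.fderiv_right (m := 1) (by norm_num)).differentiableAt (by norm_num)
  have key (v : ℂ) : fderiv ℝ (fun w => fderiv ℝ u w v) z v = fderiv ℝ (fderiv ℝ u) z v v := by
    rw [fderiv_clm_apply hd (by fun_prop)]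
    simp
  rw [InnerProductSpace.laplacian_eq_iteratedFDeriv_complexPlane]
  simp [iteratedFDeriv_two_apply, planeLaplacian, key]

lemma harmonicOnNhd_of_planeLaplacian_eq_zero {u : ℂ → ℝ} {U : Set ℂ} (hU : IsOpen U)
    (hu : ContDiffOn ℝ 2 u U) (hzero : ∀ z ∈ U, planeLaplacian u z = 0) :
    InnerProductSpace.HarmonicOnNhd u U := by
  intro z hz
  refine ⟨hu.contDiffAt (hU.mem_nhds hz), ?_⟩
  filter_upwards [hU.mem_nhds hz] with w hw
  rw [laplacian_eq_planeLaplacian (hu.contDiffAt (hU.mem_nhds hw)), hzero w hw]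
  rfl

lemma gradNorm_eq_norm_deriv {u : ℂ → ℝ} {F : ℂ → ℂ} {z : ℂ} (hF : DifferentiableAt ℂ F z)
    (hFu : (fun w => (F w).re) =ᶠ[nhds z] u) : gradNorm u z = ‖deriv F z‖ := by
  have hd : HasFDerivAt (fun w => (F w).re)
      (Complex.reCLM.comp ((fderiv ℂ F z).restrictScalars ℝ)) z :=
    Complex.reCLM.hasFDerivAt.comp z (hF.hasFDerivAt.restrictScalars ℝ)
  have hI : fderiv ℂ F z Complex.I = Complex.I * deriv F z := by
    rw [fderiv_eq_smul_deriv, smul_eq_mul]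
  rw [gradNorm, ← hFu.fderiv_eq, hd.fderiv, Complex.norm_def, Complex.normSq_apply]
  simp [hI, sq]

/-- **Gradient estimate** at the centre of a disk for holomorphic functions with nonnegative
real part. -/
lemma norm_deriv_le_of_re_nonneg {F : ℂ → ℂ} {z : ℂ} {ρ : ℝ} (hρ : 0 < ρ)
    (hF : DifferentiableOn ℂ F (ball z ρ)) (hpos : ∀ w ∈ ball z ρ, 0 ≤ (F w).re) :
    ‖deriv F z‖ ≤ 2 * (F z).re / ρ := by
  have hz : z ∈ ball z ρ := mem_ball_self hρ
  have hFz : DifferentiableAt ℂ F z := hF.differentiableAt (isOpen_ball.mem_nhds hz)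
  suffices H : ∀ ε : ℝ, 0 < ε → ‖deriv F z‖ ≤ 2 * (F z).re / ρ + ε by
    exact le_of_forall_pos_le_add H
  intro ε' hε'
  obtain ⟨ε, hε, rfl⟩ : ∃ ε : ℝ, 0 < ε ∧ 2 * ε / ρ = ε' :=
    ⟨ε' * ρ / 2, by positivity, by field_simp⟩
  set b : ℂ := starRingEnd ℂ (F z) + 2 * ε with hb
  have hre (w : ℂ) : (F w + b).re = (F w).re + (F z).re + 2 * ε := by
    simp [hb]; ring
  have him (w : ℂ) : (F w + b).im = (F w).im - (F z).im := by
    simp [hb]; ring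
  have hne (w : ℂ) (hw : w ∈ ball z ρ) : F w + b ≠ 0 := by
    intro h
    have h' := hre w
    rw [h, Complex.zero_re] at h'
    linarith [hpos w hw, hpos z hz]
  set G : ℂ → ℂ := fun w => (F w - F z) / (F w + b) with hG
  have hGz : G z = 0 := by simp [hG]
  have hGd : DifferentiableOn ℂ G (ball z ρ) :=
    (hF.sub_const _).div (hF.add_const _) hne
  have hmaps : MapsTo G (ball z ρ) (closedBall (G z) 1) := by
    intro w hw
    rw [hGz, mem_closedBall_zero_iff, hG]
    simp only [norm_div]
    refine div_le_one_of_le₀ ?_ (norm_nonneg _)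
    rw [← sq_le_sq₀ (norm_nonneg _) (norm_nonneg _), Complex.sq_norm, Complex.sq_norm,
      Complex.normSq_apply, Complex.normSq_apply, hre, him, Complex.sub_re, Complex.sub_im]
    nlinarith [hpos w hw, hpos z hz, mul_nonneg (hpos w hw) (hpos z hz),
      mul_nonneg (hpos w hw) hε.le, mul_nonneg (hpos z hz) hε.le]
  have hschwarz := Complex.norm_deriv_le_div_of_mapsTo_ball hGd hmaps hρ
  have hbz : F z + b = ((2 * ((F z).re + ε) : ℝ) : ℂ) := by
    apply Complex.ext
    · rw [hre, Complex.ofReal_re]; ring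
    · rw [him, Complex.ofReal_im]; ring
  have hderiv : deriv G z = deriv F z / (F z + b) := by
    have := (hFz.hasDerivAt.sub_const (F z)).div (hFz.hasDerivAt.add_const b) (hne z hz)
    refine HasDerivAt.deriv (this.congr_deriv ?_)
    have := hne z hz
    field_simp
    ring
  have hFε : 0 < 2 * ((F z).re + ε) := by linarith [hpos z hz]
  rw [hderiv, hbz, norm_div, Complex.norm_real, Real.norm_of_nonneg hFε.le,
    div_le_div_iff₀ hFε hρ] at hschwarz
  rw [← add_div, le_div_iff₀ hρ]
  linarith

lemma gradNorm_le_of_forall_ge {u : ℂ → ℝ} {z : ℂ} {ρ m : ℝ} (hρ : 0 < ρ)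
    (hu : InnerProductSpace.HarmonicOnNhd u (ball z ρ)) (hm : ∀ w ∈ ball z ρ, m ≤ u w) :
    gradNorm u z ≤ 2 * (u z - m) / ρ := by
  obtain ⟨F, hF, hFu⟩ := hu.exists_analyticOnNhd_ball_re_eq
  have hz : z ∈ ball z ρ := mem_ball_self hρ
  rw [gradNorm_eq_norm_deriv (hF z hz).differentiableAt
    (Filter.eventuallyEq_of_mem (isOpen_ball.mem_nhds hz) hFu)]
  have hnonneg : ∀ w ∈ ball z ρ, 0 ≤ (F w - (m : ℂ)).re := fun w hw => by
    have := hFu hw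
    simp only at this
    simpa [this] using hm w hw
  have := norm_deriv_le_of_re_nonneg hρ (hF.differentiableOn.sub_const (m : ℂ)) hnonneg
  have hz' := hFu hz
  simp only at hz'
  simpa [hz'] using this

lemma gradNorm_le_of_forall_le {u : ℂ → ℝ} {z : ℂ} {ρ M : ℝ} (hρ : 0 < ρ)
    (hu : InnerProductSpace.HarmonicOnNhd u (ball z ρ)) (hM : ∀ w ∈ ball z ρ, u w ≤ M) :
    gradNorm u z ≤ 2 * (M - u z) / ρ := by
  obtain ⟨F, hF, hFu⟩ := hu.exists_analyticOnNhd_ball_re_eq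
  have hz : z ∈ ball z ρ := mem_ball_self hρ
  rw [gradNorm_eq_norm_deriv (hF z hz).differentiableAt
    (Filter.eventuallyEq_of_mem (isOpen_ball.mem_nhds hz) hFu)]
  have hnonneg : ∀ w ∈ ball z ρ, 0 ≤ ((M : ℂ) - F w).re := fun w hw => by
    have := hFu hw
    simp only at this
    simpa [this] using hM w hw
  have := norm_deriv_le_of_re_nonneg hρ (hF.differentiableOn.const_sub (M : ℂ)) hnonneg
  have hz' := hFu hz
  simp only at hz'
  simpa [hz', deriv_const_sub] using this

/-- A preconnected set covered by two disjoint closed sets and meeting the first one lies in it. -/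
lemma subset_left_of_isClosed {X : Type*} [TopologicalSpace X] {S A B : Set X}
    (hS : IsPreconnected S) (hA : IsClosed A) (hB : IsClosed B) (hAB : Disjoint A B)
    (hcover : S ⊆ A ∪ B) (hne : (S ∩ A).Nonempty) : S ⊆ A := by
  intro x hx
  by_contra hxA
  obtain ⟨y, -, hyA, hyB⟩ := isPreconnected_closed_iff.1 hS A B hA hB hcover hne
    ⟨x, hx, (hcover hx).resolve_left hxA⟩
  exact hAB.notMem_of_mem_left hyA hyB

section Frontier

variable {n : ℕ} {c : Fin n → ℂ} {R r : ℝ} {z : ℂ}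

lemma isOpen_compl_iUnion_closedBall (c : Fin n → ℂ) (s : ℝ) :
    IsOpen (⋃ j, closedBall (c j) s)ᶜ :=
  (isClosed_iUnion_of_finite fun _ => isClosed_closedBall).isOpen_compl

/-- A frontier point of the perforated annulus lies in the closed annulus, outside the open
holes. -/
lemma bounds_of_mem_frontier
    (hz : z ∈ frontier ({z : ℂ | r / 2 < ‖z‖ ∧ ‖z‖ < R - 1} \ ⋃ j, closedBall (c j) 3)) :
    (r / 2 ≤ ‖z‖ ∧ ‖z‖ ≤ R - 1) ∧ ∀ j, 3 ≤ dist z (c j) := by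
  have hcl : IsClosed {z : ℂ | (r / 2 ≤ ‖z‖ ∧ ‖z‖ ≤ R - 1) ∧ ∀ j, 3 ≤ dist z (c j)} := by
    refine IsClosed.inter (IsClosed.inter ?_ ?_) ?_
    · exact isClosed_le continuous_const continuous_norm
    · exact isClosed_le continuous_norm continuous_const
    · have : {z : ℂ | ∀ j, 3 ≤ dist z (c j)} = ⋂ j, {z : ℂ | 3 ≤ dist z (c j)} := by
        ext; simp
      change IsClosed {z : ℂ | ∀ j, 3 ≤ dist z (c j)}
      rw [this]
      exact isClosed_iInter fun j =>
        isClosed_le continuous_const (continuous_id.dist continuous_const)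
  refine closure_minimal ?_ hcl (frontier_subset_closure hz)
  rintro w ⟨⟨h1, h2⟩, h3⟩
  refine ⟨⟨h1.le, h2.le⟩, fun j => ?_⟩
  simp only [mem_iUnion, mem_closedBall, not_exists, not_le] at h3
  exact (h3 j).le

lemma mem_circle_or_disk_of_mem_frontier
    (hz : z ∈ frontier ({z : ℂ | r / 2 < ‖z‖ ∧ ‖z‖ < R - 1} \ ⋃ j, closedBall (c j) 3)) :
    ‖z‖ = r / 2 ∨ ‖z‖ = R - 1 ∨ ∃ j, dist z (c j) = 3 := by
  obtain ⟨⟨h1, h2⟩, h3⟩ := bounds_of_mem_frontier hz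
  by_contra! hcon
  obtain ⟨hc1, hc2, hc3⟩ := hcon
  have hopen : IsOpen ({z : ℂ | r / 2 < ‖z‖ ∧ ‖z‖ < R - 1} \ ⋃ j, closedBall (c j) 3) :=
    ((isOpen_lt continuous_const continuous_norm).inter
      (isOpen_lt continuous_norm continuous_const)).inter (isOpen_compl_iUnion_closedBall c 3)
  rw [hopen.frontier_eq] at hz
  refine hz.2 ⟨⟨lt_of_le_of_ne h1 hc1.symm, lt_of_le_of_ne h2 hc2⟩, ?_⟩
  simp only [mem_iUnion, mem_closedBall, not_exists, not_le]
  exact fun j => lt_of_le_of_ne (h3 j) (hc3 j).symm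

/-- The component of the frontier meeting the inner circle consists of points of the inner circle
and of boundary points of the holes that meet the inner disk. -/
lemma mem_circle_or_disk_of_mem_component {w : ℂ}
    (hsep : ∀ i j : Fin n, i ≠ j → 102 ≤ dist (c i) (c j)) (hgap : r / 2 + 7 < R)
    (hw : w ∈ frontier ({z : ℂ | r / 2 < ‖z‖ ∧ ‖z‖ < R - 1} \ ⋃ j, closedBall (c j) 3))
    (hwr : ‖w‖ = r / 2)
    (hz : z ∈ connectedComponentIn
      (frontier ({z : ℂ | r / 2 < ‖z‖ ∧ ‖z‖ < R - 1} \ ⋃ j, closedBall (c j) 3)) w) :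
    ‖z‖ = r / 2 ∨ ∃ j, ‖c j‖ ≤ r / 2 + 3 ∧ dist z (c j) = 3 := by
  let A : Set ℂ := {z | ‖z‖ = r / 2} ∪ ⋃ j : {j // ‖c j‖ ≤ r / 2 + 3}, closedBall (c j) 3
  let B : Set ℂ := {z | ‖z‖ = R - 1} ∪ ⋃ j : {j // r / 2 + 3 < ‖c j‖}, closedBall (c j) 3
  have hA : IsClosed A := (isClosed_eq continuous_norm continuous_const).union
    (isClosed_iUnion_of_finite fun _ => isClosed_closedBall)
  have hB : IsClosed B := (isClosed_eq continuous_norm continuous_const).union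
    (isClosed_iUnion_of_finite fun _ => isClosed_closedBall)
  have htri (x : ℂ) (j : Fin n) : ‖x‖ ≤ ‖c j‖ + dist x (c j) ∧ ‖c j‖ ≤ ‖x‖ + dist x (c j) := by
    have h1 := norm_le_norm_add_norm_sub (c j) x
    have h2 := norm_le_norm_add_norm_sub x (c j)
    rw [← dist_eq_norm, dist_comm] at h1
    rw [← dist_eq_norm] at h2
    constructor <;> linarith
  have hAB : Disjoint A B := by
    rw [Set.disjoint_left]
    rintro x (hx | hx) (hx' | hx')
    · have h1 : ‖x‖ = r / 2 := hx
      have h2 : ‖x‖ = R - 1 := hx'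
      linarith
    · obtain ⟨⟨j, hj⟩, hxj⟩ := mem_iUnion.1 hx'
      have h1 : ‖x‖ = r / 2 := hx
      have h2 : dist x (c j) ≤ 3 := hxj
      linarith [(htri x j).2]
    · obtain ⟨⟨j, hj⟩, hxj⟩ := mem_iUnion.1 hx
      have h1 : ‖x‖ = R - 1 := hx'
      have h2 : dist x (c j) ≤ 3 := hxj
      linarith [(htri x j).1]
    · obtain ⟨⟨i, hi⟩, hxi⟩ := mem_iUnion.1 hx
      obtain ⟨⟨j, hj⟩, hxj⟩ := mem_iUnion.1 hx'
      have h1 : dist x (c i) ≤ 3 := hxi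
      have h2 : dist x (c j) ≤ 3 := hxj
      have hij : i ≠ j := by rintro rfl; linarith
      linarith [hsep i j hij, dist_triangle_left (c i) (c j) x]
  have hsub := subset_left_of_isClosed isPreconnected_connectedComponentIn hA hB hAB
    (fun x hx => ?_) ⟨w, mem_connectedComponentIn hw, Or.inl hwr⟩
  · rcases hsub hz with h | h
    · exact Or.inl h
    · obtain ⟨⟨j, hj⟩, hzj⟩ := mem_iUnion.1 h
      exact Or.inr ⟨j, hj, le_antisymm hzj
        ((bounds_of_mem_frontier (connectedComponentIn_subset _ _ hz)).2 j)⟩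
  · rcases mem_circle_or_disk_of_mem_frontier (connectedComponentIn_subset _ _ hx) with
      h | h | ⟨j, hj⟩
    · exact Or.inl (Or.inl h)
    · exact Or.inr (Or.inl h)
    · rcases le_or_gt ‖c j‖ (r / 2 + 3) with hc | hc
      · exact Or.inl (Or.inr (mem_iUnion.2 ⟨⟨j, hc⟩, hj.le⟩))
      · exact Or.inr (Or.inr (mem_iUnion.2 ⟨⟨j, hc⟩, hj.le⟩))

/-- A bound near the origin passes to the point of a hole closest to the origin. -/
lemma exists_mem_sphere_abs_le {h : ℂ → ℝ} {M : ℝ} {j : Fin n}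
    (hsep : ∀ i j : Fin n, i ≠ j → 102 ≤ dist (c i) (c j))
    (hcj : 3 < ‖c j‖) (hcjr : ‖c j‖ < r + 3)
    (hcont : ∀ z ∈ sphere (c j) 3, ContinuousAt h z)
    (hM : ∀ z ∈ ball (0 : ℂ) r \ ⋃ i, closedBall (c i) 3, |h z| ≤ M) :
    ∃ p ∈ sphere (c j) 3, |h p| ≤ M := by
  have hpos : 0 < ‖c j‖ := by linarith
  have hdist (t : ℝ) (ht : t ≤ 1) : dist ((t : ℂ) * c j) (c j) = (1 - t) * ‖c j‖ := by
    rw [dist_eq_norm, show (t : ℂ) * c j - c j = ((t - 1 : ℝ) : ℂ) * c j by push_cast; ring,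
      norm_mul, Complex.norm_real, Real.norm_of_nonpos (by linarith)]
    ring
  set t₀ : ℝ := 1 - 3 / ‖c j‖ with ht₀
  have hdiv : 3 / ‖c j‖ < 1 := (div_lt_one hpos).2 hcj
  have hdiv0 : 0 < 3 / ‖c j‖ := by positivity
  have ht₀n : t₀ * ‖c j‖ = ‖c j‖ - 3 := by rw [ht₀]; field_simp
  have hp : (t₀ : ℂ) * c j ∈ sphere (c j) 3 := by
    rw [mem_sphere, hdist t₀ (by linarith)]
    linarith
  refine ⟨_, hp, ?_⟩
  have hline : Continuous fun t : ℝ => (t : ℂ) * c j := by fun_prop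
  have hlim : Filter.Tendsto (fun t : ℝ => |h ((t : ℂ) * c j)|) (nhdsWithin t₀ (Iio t₀))
      (nhds |h ((t₀ : ℂ) * c j)|) :=
    ((hcont _ hp).comp (f := fun t : ℝ => (t : ℂ) * c j) hline.continuousAt).abs.tendsto.mono_left
      nhdsWithin_le_nhds
  refine le_of_tendsto hlim ?_
  have hIoo : Ioo (max 0 (t₀ - 1 / ‖c j‖)) t₀ ∈ nhdsWithin t₀ (Iio t₀) :=
    Ioo_mem_nhdsLT (max_lt (by linarith) (by linarith [show 0 < 1 / ‖c j‖ by positivity]))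
  filter_upwards [hIoo] with t ⟨htmax, htlt⟩
  obtain ⟨ht0, htclose⟩ := max_lt_iff.1 htmax
  have htn : t * ‖c j‖ < ‖c j‖ - 3 := by
    rw [← ht₀n]; exact mul_lt_mul_of_pos_right htlt hpos
  have ht1 : t ≤ 1 := by linarith
  have hnorm : ‖(t : ℂ) * c j‖ = t * ‖c j‖ := by
    rw [norm_mul, Complex.norm_real, Real.norm_of_nonneg ht0.le]
  refine hM _ ⟨by rw [mem_ball_zero_iff, hnorm]; linarith, ?_⟩
  simp only [mem_iUnion, mem_closedBall, not_exists, not_le]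
  intro i
  by_cases hij : i = j
  · rw [hij, hdist t ht1]
    linarith
  · have h1 := hdist t ht1
    have h4 : ‖c j‖ - 4 < t * ‖c j‖ := by
      have := mul_lt_mul_of_pos_right htclose hpos
      rwa [sub_mul, ht₀n, one_div_mul_cancel hpos.ne', sub_sub,
        show (3 : ℝ) + 1 = 4 by norm_num] at this
    have h2 := dist_triangle_left (c i) (c j) ((t : ℂ) * c j)
    have h3 := hsep i j hij
    linarith

end Frontier

/-- The power factors absorbing all constants. -/
lemma rpow_absorbs {R r k C : ℝ} (hR : 2 ^ 10 ≤ R) (hC : 10 ≤ C) (hr : 0 < r)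
    (hrR : r < R / 2 ^ 10) (hk : 2 * C * R ≤ k) :
    4 * (16 * r / R) ^ k ≤ 1 ∧ 4 * (16 * r / R) ^ k ≤ r / 2 ∧ C * (16 * r / R) ^ k ≤ 1 := by
  have hR0 : 0 < R := by linarith
  set X : ℝ := 16 * r / R with hX
  have hX0 : 0 < X := by positivity
  have hX1 : X < 1 / 64 := by
    rw [hX, div_lt_iff₀ hR0]; linarith
  have hCk : C ≤ k := by nlinarith
  have hXk : X ^ k ≤ X := by
    simpa using Real.rpow_le_rpow_of_exponent_ge hX0 (by linarith) (by linarith : (1 : ℝ) ≤ k)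
  refine ⟨by linarith, ?_, ?_⟩
  · have hXr : X * 64 ≤ r := by
      rw [hX, div_mul_eq_mul_div, div_le_iff₀ hR0]; nlinarith
    linarith
  · have hinv : 64 ≤ X⁻¹ := by
      rw [le_inv_comm₀ (by norm_num) hX0]; linarith
    have hbern := one_add_mul_self_le_rpow_one_add (s := X⁻¹ - 1) (by linarith)
      (p := k) (by linarith)
    rw [add_sub_cancel, Real.inv_rpow hX0.le] at hbern
    have hpow : 0 < X ^ k := Real.rpow_pos_of_pos hX0 k
    have : C ≤ (X ^ k)⁻¹ := by nlinarith
    rwa [← one_div, le_div_iff₀ hpow] at this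

end W1Bound

open W1Bound in
/-- The inner-boundary estimate (W1Bound) in the proof of Proposition 2.2.
Here `Ω = {r/2 < |z| < R−1} ∖ ∪ 3D_j`, the disks `D_j = closedBall (c j) 1` are
`100`-separated (centers `102`-separated), `0 ∉ ∪ 3D_j`, `R ≥ 2^{10}`, `h` is
harmonic in `B(0,R) ∖ ∪ D_j` and does not change sign in `(5D_j ∖ D_j) ∩ B(0,R)`,
`C_H ≥ 10` satisfies the conclusions of Lemma 2.1 for all `j` with `3D_j ⊆ B(0,R)`,
`r ∈ (0, R/2^{10})`, `k ≥ 2C_H R`, and `sup_{B(0,r) ∖ ∪3D_j} |h| ≤ (16r/R)^{3k}`.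
Then on the connected component `W₁` of `∂Ω` meeting the circle `{|z| = r/2}`,
both `|h| ≤ (16r/R)^{2k}` and `|∇h| ≤ (16r/R)^{2k}`. -/
theorem W1_bound (n : ℕ) (c : Fin n → ℂ) (R r k C_H : ℝ) (h : ℂ → ℝ)
    (hsep : ∀ i j : Fin n, i ≠ j → 102 ≤ dist (c i) (c j))
    (h0 : (0:ℂ) ∉ ⋃ j, Metric.closedBall (c j) 3)
    (hR : 2 ^ 10 ≤ R)
    (hreg : ContDiffOn ℝ 2 h (Metric.ball (0:ℂ) R \ ⋃ j, Metric.closedBall (c j) 1))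
    (hharm : ∀ z ∈ Metric.ball (0:ℂ) R \ ⋃ j, Metric.closedBall (c j) 1,
      planeLaplacian h z = 0)
    (hsign : ∀ j : Fin n,
      (∀ z ∈ (Metric.closedBall (c j) 5 \ Metric.closedBall (c j) 1) ∩ Metric.ball (0:ℂ) R,
        0 ≤ h z) ∨
      (∀ z ∈ (Metric.closedBall (c j) 5 \ Metric.closedBall (c j) 1) ∩ Metric.ball (0:ℂ) R,
        h z ≤ 0))
    (hCH : 10 ≤ C_H)
    (hlem : ∀ j : Fin n, Metric.closedBall (c j) 3 ⊆ Metric.ball (0:ℂ) R →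
      (∀ z ∈ Metric.sphere (c j) 3, ∀ w ∈ Metric.sphere (c j) 3, |h z| ≤ C_H * |h w|) ∧
      (∀ z ∈ Metric.sphere (c j) 3, ∀ w ∈ Metric.sphere (c j) 3,
        gradNorm h z ≤ C_H * |h w|))
    (hr : 0 < r) (hrR : r < R / 2 ^ 10)
    (hk : 2 * C_H * R ≤ k)
    (hsmall : ∀ z ∈ Metric.ball (0:ℂ) r \ ⋃ j, Metric.closedBall (c j) 3,
      |h z| ≤ (16 * r / R) ^ (3 * k)) :
    ∀ w ∈ frontier ({z : ℂ | r / 2 < ‖z‖ ∧ ‖z‖ < R - 1} \ ⋃ j, Metric.closedBall (c j) 3),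
      ‖w‖ = r / 2 →
      ∀ z ∈ connectedComponentIn
          (frontier ({z : ℂ | r / 2 < ‖z‖ ∧ ‖z‖ < R - 1} \ ⋃ j, Metric.closedBall (c j) 3)) w,
        |h z| ≤ (16 * r / R) ^ (2 * k) ∧ gradNorm h z ≤ (16 * r / R) ^ (2 * k) := by
  intro w hw hwr z hz
  have hrR' : r * 1024 < R := by linarith
  obtain ⟨hX1, hX2, hX3⟩ := rpow_absorbs hR hCH hr hrR hk
  set X : ℝ := 16 * r / R with hX
  have hX0 : 0 < X := by positivity
  have hsplit : X ^ (3 * k) = X ^ k * X ^ (2 * k) := by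
    rw [← Real.rpow_add hX0]; ring_nf
  have hpow : 0 < X ^ k := Real.rpow_pos_of_pos hX0 _
  have hpow2 : 0 < X ^ (2 * k) := Real.rpow_pos_of_pos hX0 _
  have hopen : IsOpen (ball (0 : ℂ) R \ ⋃ j, closedBall (c j) 1) :=
    isOpen_ball.inter (isOpen_compl_iUnion_closedBall c 1)
  have hharm' := harmonicOnNhd_of_planeLaplacian_eq_zero hopen hreg hharm
  have hge := (bounds_of_mem_frontier (connectedComponentIn_subset _ _ hz)).2
  by_cases hdisk : ∃ j, ‖c j‖ ≤ r / 2 + 3 ∧ dist z (c j) = 3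
  · obtain ⟨j, hcj, hzj⟩ := hdisk
    have hcj3 : 3 < ‖c j‖ := by
      by_contra! hcon
      exact h0 (mem_iUnion.2 ⟨j, by simpa using hcon⟩)
    have hsub : closedBall (c j) 3 ⊆ ball (0 : ℂ) R := by
      intro x hx
      rw [mem_closedBall, dist_eq_norm] at hx
      rw [mem_ball_zero_iff]
      linarith [norm_le_norm_add_norm_sub (c j) x, norm_sub_rev (c j) x]
    have hcont : ∀ x ∈ sphere (c j) 3, ContinuousAt h x := by
      intro x hx
      refine (hreg.contDiffAt
        (hopen.mem_nhds ⟨hsub (sphere_subset_closedBall hx), ?_⟩)).continuousAt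
      simp only [mem_iUnion, mem_closedBall, not_exists, not_le]
      intro i
      rw [mem_sphere] at hx
      by_cases hij : i = j
      · rw [hij]; linarith
      · linarith [hsep i j hij, dist_triangle_left (c i) (c j) x]
    obtain ⟨p, hp, hpM⟩ := exists_mem_sphere_abs_le hsep hcj3 (by linarith) hcont hsmall
    have hb : C_H * |h p| ≤ X ^ (2 * k) := by
      rw [hsplit] at hpM
      nlinarith [mul_le_mul_of_nonneg_right hX3 hpow2.le]
    exact ⟨((hlem j hsub).1 z hzj p hp).trans hb, ((hlem j hsub).2 z hzj p hp).trans hb⟩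
  have hzr : ‖z‖ = r / 2 := (mem_circle_or_disk_of_mem_component hsep (by linarith) hw hwr
    hz).resolve_right hdisk
  have hgt (j : Fin n) : 3 < dist z (c j) := by
    refine lt_of_le_of_ne (hge j) fun hj => hdisk ⟨j, ?_, hj.symm⟩
    have := norm_le_norm_add_norm_sub z (c j)
    rw [← dist_eq_norm] at this
    linarith
  have hsz : |h z| ≤ X ^ (3 * k) := by
    refine hsmall z ⟨by rw [mem_ball_zero_iff]; linarith, ?_⟩
    simpa only [mem_iUnion, mem_closedBall, not_exists, not_le] using hgt
  have hznorm (x : ℂ) : ‖x‖ ≤ r / 2 + dist x z := by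
    rw [dist_eq_norm, ← hzr]
    linarith [norm_le_norm_add_norm_sub z x, norm_sub_rev z x]
  refine ⟨by rw [hsplit] at hsz; nlinarith, ?_⟩
  by_cases hnear : ∃ j, dist z (c j) < 4
  · obtain ⟨j, hj⟩ := hnear
    have hball : ball z 1 ⊆
        (closedBall (c j) 5 \ closedBall (c j) 1) ∩ ball (0 : ℂ) R := by
      intro x hx
      rw [mem_ball] at hx
      refine ⟨⟨?_, ?_⟩, ?_⟩
      · rw [mem_closedBall]; linarith [dist_triangle x z (c j)]
      · rw [mem_closedBall]; linarith [dist_triangle_left z (c j) x, hgt j]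
      · rw [mem_ball_zero_iff]; linarith [hznorm x]
    have hU : ball z 1 ⊆ ball (0 : ℂ) R \ ⋃ j, closedBall (c j) 1 := by
      intro x hx
      refine ⟨(hball hx).2, ?_⟩
      rw [mem_ball] at hx
      simp only [mem_iUnion, mem_closedBall, not_exists, not_le]
      intro i
      linarith [dist_triangle_left z (c i) x, hgt i]
    have hgrad : gradNorm h z ≤ 2 * |h z| := by
      rcases hsign j with hs | hs
      · have := gradNorm_le_of_forall_ge one_pos (fun x hx => hharm' x (hU hx))
          (fun x hx => hs x (hball hx))
        linarith [le_abs_self (h z)]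
      · have := gradNorm_le_of_forall_le one_pos (fun x hx => hharm' x (hU hx))
          (fun x hx => hs x (hball hx))
        linarith [neg_le_abs (h z)]
    rw [hsplit] at hsz
    nlinarith
  · push Not at hnear
    set ρ : ℝ := min (r / 2) 1 with hρ
    have hρ0 : 0 < ρ := lt_min (by linarith) one_pos
    have hρr : ρ ≤ r / 2 := min_le_left _ _
    have hρ1 : ρ ≤ 1 := min_le_right _ _
    have hfar (x : ℂ) (hx : x ∈ ball z ρ) (i : Fin n) : 3 < dist x (c i) := by
      rw [mem_ball] at hx
      linarith [dist_triangle_left z (c i) x, hnear i]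
    have hnorm (x : ℂ) (hx : x ∈ ball z ρ) : ‖x‖ < r := by
      rw [mem_ball] at hx
      linarith [hznorm x]
    have hgrad := gradNorm_le_of_forall_le (M := X ^ (3 * k)) hρ0
      (fun x hx => hharm' x ⟨by rw [mem_ball_zero_iff]; linarith [hnorm x hx], by
        simp only [mem_iUnion, mem_closedBall, not_exists, not_le]
        exact fun i => by linarith [hfar x hx i]⟩)
      (fun x hx => (le_abs_self _).trans (hsmall x ⟨by
        rw [mem_ball_zero_iff]; exact hnorm x hx, by
        simpa only [mem_iUnion, mem_closedBall, not_exists, not_le] using hfar x hx⟩))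
    refine hgrad.trans ?_
    rw [div_le_iff₀ hρ0]
    have h4 : 4 * X ^ k ≤ ρ := le_min hX2 hX1
    have := neg_le_abs (h z)
    rw [hsplit] at hsz ⊢
    nlinarith [mul_le_mul_of_nonneg_right h4 hpow2.le]
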